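/- For all real numbers A and B with A ≥ B > 0, there exists a positive integer m such that A·2^{−m} + B·2^{m} ≤ 3·sqrt(A·B). -/

import Mathlib

theorem stmt_11 (A B : ℝ) (hAB : B ≤ A) (hB : 0 < B) :
    ∃ m : ℕ, 0 < m ∧ A * 2 ^ (-(m:ℤ)) + B * 2 ^ m ≤ 3 * Real.sqrt (A * B) := by
  have hA : 0 < A := hB.trans_le hAB
  have ha : 0 < √A := Real.sqrt_pos.2 hA
  have hb : 0 < √B := Real.sqrt_pos.2 hB
  obtain ⟨k, hk₁, hk₂⟩ := exists_nat_pow_near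
    ((one_le_div hb).2 (Real.sqrt_le_sqrt hAB)) (one_lt_two : (1 : ℝ) < 2)
  rw [le_div_iff₀ hb] at hk₁
  rw [div_lt_iff₀ hb, pow_succ] at hk₂
  refine ⟨k + 1, k.succ_pos, ?_⟩
  rw [Real.sqrt_mul hA.le, zpow_neg, zpow_natCast, pow_succ]
  nth_rewrite 1 [← Real.sq_sqrt hA.le]
  nth_rewrite 1 [← Real.sq_sqrt hB.le]
  have hp : (0 : ℝ) < 2 ^ k := by positivity
  generalize (2 : ℝ) ^ k = p at *
  generalize √A = a at *
  generalize √B = b at *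
  have hpb : 0 < p * b := mul_pos hp hb
  have key : a ^ 2 + b ^ 2 * (p * 2) ^ 2 ≤ 3 * (a * b) * (p * 2) := by
    nlinarith [mul_nonneg (sub_nonneg.2 hk₁) (by linarith : 0 ≤ 4 * (p * b) - a),
      mul_pos ha hpb]
  calc a ^ 2 * (p * 2)⁻¹ + b ^ 2 * (p * 2)
      = (a ^ 2 + b ^ 2 * (p * 2) ^ 2) / (p * 2) := by field_simp
    _ ≤ 3 * (a * b) := (div_le_iff₀ (by positivity)).2 key
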